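/- arXiv:1705.01199 — 3 statements merged into one kernel-verified Lean document; each statement's English description precedes it below -/
import Mathlib

section
/- Suppose G_0, G_1, …, G_m is a chain decomposition of a multigraph G rooted at r. Then for every i = 1, …, m, the subgraphs H_i and Hbar_{i−1} are connected. -/
set_option autoImplicit false

/-- A multigraph: a type of vertices, a type of edges, and a map assigning to each
edge its unordered pair of endpoints (a loop has endpoints `s(v, v)`). -/
structure MG : Type 1 where
  V : Type
  E : Type
  ends : E → Sym2 V

namespace MG

variable (G : MG)

/-- The set of vertices covered by a set `F` of edges. -/
def vertsOf (F : Set G.E) : Set G.V := {v | ∃ e ∈ F, v ∈ G.ends e}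

/-- The degree of a vertex `v` with respect to a set `F` of edges;
a loop contributes two to the degree. -/
noncomputable def deg (F : Set G.E) (v : G.V) : ℕ :=
  {e ∈ F | v ∈ G.ends e}.ncard + {e ∈ F | G.ends e = s(v, v)}.ncard

/-- `G` has no isolated vertices. -/
def NoIsolated : Prop := ∀ v : G.V, ∃ e : G.E, v ∈ G.ends e

/-- `IsLink vs es`: the edge list `es` successively links the consecutive
vertices of the vertex list `vs`. -/
def IsLink : List G.V → List G.E → Prop
  | [_], [] => True
  | a :: b :: vs, e :: es => G.ends e = s(a, b) ∧ IsLink (b :: vs) es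
  | _, _ => False

/-- `vs, es` form a (simple) path: distinct vertices, distinct edges, consecutive linking. -/
def IsPath (vs : List G.V) (es : List G.E) : Prop :=
  vs.Nodup ∧ es.Nodup ∧ G.IsLink vs es

/-- `v :: vs, es` form a (simple) cycle through the basepoint `v`:
the distinct vertices `v :: vs` are linked cyclically by the distinct edges `es`.
A loop gives a cycle of length one and two parallel edges give a cycle of length two. -/
def IsCycle (v : G.V) (vs : List G.V) (es : List G.E) : Prop :=
  (v :: vs).Nodup ∧ es.Nodup ∧ es ≠ [] ∧ G.IsLink (v :: (vs ++ [v])) es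

/-- Reachability using only edges from `F`. -/
def Reach (F : Set G.E) : G.V → G.V → Prop :=
  Relation.ReflTransGen (fun a b => ∃ e ∈ F, G.ends e = s(a, b))

/-- `G` with edge set restricted to `F` is connected as a graph on all of `G.V`. -/
def ConnectedOn (F : Set G.E) : Prop := ∀ a b : G.V, G.Reach F a b

/-- The subgraph formed by the edge set `F` together with the vertices it covers
is connected. -/
def ConnectedWithin (F : Set G.E) : Prop :=
  ∀ a ∈ G.vertsOf F, ∀ b ∈ G.vertsOf F, G.Reach F a b

/-- `G` is 4-edge-connected: at least two vertices, and deleting any set of fewer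
than four edges leaves the graph connected. -/
def FourEdgeConnected : Prop :=
  2 ≤ Nat.card G.V ∧ ∀ S : Set G.E, S.Finite → S.ncard < 4 → G.ConnectedOn Sᶜ

/-- `e` is a cut edge of the subgraph formed by the edge set `F`: removing `e`
disconnects two vertices of that subgraph. -/
def IsCutEdge (F : Set G.E) (e : G.E) : Prop :=
  e ∈ F ∧ ∃ a ∈ G.vertsOf F, ∃ b ∈ G.vertsOf F, ¬ G.Reach (F \ {e}) a b

/-! ### Chains -/

/-- An open up chain with respect to `(H, Hb)`, rooted at `r`: a path with at least
one edge, edge-disjoint from `H` and `Hb`, in which every vertex is `r` or has degree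
at least two in `Hb`, and whose ends are `r` or lie in `H`. -/
def IsOpenUpChain (r : G.V) (H Hb C : Set G.E) : Prop :=
  Disjoint C H ∧ Disjoint C Hb ∧
  ∃ vs es, G.IsPath vs es ∧ es ≠ [] ∧ C = {e | e ∈ es} ∧
    (∀ v ∈ vs, v = r ∨ 2 ≤ G.deg Hb v) ∧
    (∀ v, vs.head? = some v → v = r ∨ v ∈ G.vertsOf H) ∧
    (∀ v, vs.getLast? = some v → v = r ∨ v ∈ G.vertsOf H)

/-- A closed up chain with respect to `(H, Hb)`, rooted at `r`, with common end `v`: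
a cycle through `v`, edge-disjoint from `H` and `Hb`, in which every vertex is `r` or
has degree at least two in `Hb`, and the end `v` is `r` or has degree at least two in `H`. -/
def IsClosedUpChain (r : G.V) (H Hb C : Set G.E) (v : G.V) : Prop :=
  Disjoint C H ∧ Disjoint C Hb ∧
  ∃ vs es, G.IsCycle v vs es ∧ C = {e | e ∈ es} ∧
    (∀ u ∈ v :: vs, u = r ∨ 2 ≤ G.deg Hb u) ∧
    (v = r ∨ 2 ≤ G.deg H v)

/-- An up chain with respect to `(H, Hb)`. -/
def IsUpChain (r : G.V) (H Hb C : Set G.E) : Prop :=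
  G.IsOpenUpChain r H Hb C ∨ ∃ v, G.IsClosedUpChain r H Hb C v

/-- A down chain with respect to `(H, Hb)` is an up chain with respect to `(Hb, H)`. -/
def IsDownChain (r : G.V) (H Hb C : Set G.E) : Prop := G.IsUpChain r Hb H C

/-- A closed down chain with respect to `(H, Hb)` with common end `v`. -/
def IsClosedDownChain (r : G.V) (H Hb C : Set G.E) (v : G.V) : Prop :=
  G.IsClosedUpChain r Hb H C v

/-- A one-way chain with respect to `(H, Hb)`, with tail `u` and head `v`:
a single edge `e ∉ H ∪ Hb` with ends `u` and `v`, where the tail `u` is `r` or has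
degree at least two in `H`, and the head `v` is `r` or has degree at least two in `Hb`. -/
def IsOneWayChainAt (r : G.V) (H Hb C : Set G.E) (u v : G.V) : Prop :=
  ∃ e, e ∉ H ∧ e ∉ Hb ∧ C = {e} ∧ G.ends e = s(u, v) ∧
    (u = r ∨ 2 ≤ G.deg H u) ∧ (v = r ∨ 2 ≤ G.deg Hb v)

/-- A one-way chain with respect to `(H, Hb)`. -/
def IsOneWayChain (r : G.V) (H Hb C : Set G.E) : Prop :=
  ∃ u v, G.IsOneWayChainAt r H Hb C u v

/-- A chain with respect to `(H, Hb)`: an up chain, a down chain, or a one-way chain. -/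
def IsChain (r : G.V) (H Hb C : Set G.E) : Prop :=
  G.IsUpChain r H Hb C ∨ G.IsDownChain r H Hb C ∨ G.IsOneWayChain r H Hb C

/-- `H_i`: the union of the chains with index `< i`. -/
def before {n : ℕ} (Gs : Fin n → Set G.E) (i : Fin n) : Set G.E :=
  {e | ∃ j, j < i ∧ e ∈ Gs j}

/-- `Hbar_i`: the union of the chains with index `> i`. -/
def after {n : ℕ} (Gs : Fin n → Set G.E) (i : Fin n) : Set G.E :=
  {e | ∃ j, i < j ∧ e ∈ Gs j}

/-- `Gs` is a chain decomposition, rooted at `r`, of the part of `G` with edge set `F`: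
the `Gs i` partition `F`, and each `Gs i` is an up chain, a down chain or a one-way
chain with respect to `(H_i, Hbar_i)`. -/
def IsChainDecompOn (F : Set G.E) (r : G.V) {n : ℕ} (Gs : Fin n → Set G.E) : Prop :=
  (∀ i j, i ≠ j → Disjoint (Gs i) (Gs j)) ∧ (⋃ i, Gs i) = F ∧
  ∀ i, G.IsChain r (G.before Gs i) (G.after Gs i) (Gs i)

/-- `Gs` is a chain decomposition of `G` rooted at `r`. -/
def IsChainDecomp (r : G.V) {n : ℕ} (Gs : Fin n → Set G.E) : Prop :=
  G.IsChainDecompOn Set.univ r Gs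

/-- `G` has a chain decomposition rooted at `r`. -/
def HasChainDecomp (r : G.V) : Prop :=
  ∃ (m : ℕ) (Gs : Fin (m + 1) → Set G.E), G.IsChainDecomp r Gs

/-- A minimal open up chain: an open up chain none of whose internal vertices
lies in `{r} ∪ V(H)`. -/
def IsMinimalOpenUpChain (r : G.V) (H Hb C : Set G.E) : Prop :=
  Disjoint C H ∧ Disjoint C Hb ∧
  ∃ vs es, G.IsPath vs es ∧ es ≠ [] ∧ C = {e | e ∈ es} ∧
    (∀ v ∈ vs, v = r ∨ 2 ≤ G.deg Hb v) ∧
    (∀ v, vs.head? = some v → v = r ∨ v ∈ G.vertsOf H) ∧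
    (∀ v, vs.getLast? = some v → v = r ∨ v ∈ G.vertsOf H) ∧
    (∀ v ∈ vs, vs.head? ≠ some v → vs.getLast? ≠ some v → v ≠ r ∧ v ∉ G.vertsOf H)

/-- A minimal up chain: an up chain none of whose internal vertices lies in
`{r} ∪ V(H)`. -/
def IsMinimalUpChain (r : G.V) (H Hb C : Set G.E) : Prop :=
  G.IsMinimalOpenUpChain r H Hb C ∨
  ∃ v, G.IsClosedUpChain r H Hb C v ∧
    ∀ u ∈ G.vertsOf C, u ≠ v → u ≠ r ∧ u ∉ G.vertsOf H

/-- A minimal down chain: a down chain none of whose internal vertices lies in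
`{r} ∪ V(Hb)`. -/
def IsMinimalDownChain (r : G.V) (H Hb C : Set G.E) : Prop :=
  G.IsMinimalUpChain r Hb H C

/-- A minimal chain decomposition (of the part of `G` with edge set `F`):
a chain decomposition all of whose up chains and down chains are minimal. -/
def IsMinimalChainDecompOn (F : Set G.E) (r : G.V) {n : ℕ} (Gs : Fin n → Set G.E) : Prop :=
  G.IsChainDecompOn F r Gs ∧
  ∀ i, G.IsMinimalUpChain r (G.before Gs i) (G.after Gs i) (Gs i) ∨
       G.IsMinimalDownChain r (G.before Gs i) (G.after Gs i) (Gs i) ∨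
       G.IsOneWayChain r (G.before Gs i) (G.after Gs i) (Gs i)

/-- A minimal chain decomposition of `G` rooted at `r`. -/
def IsMinimalChainDecomp (r : G.V) {n : ℕ} (Gs : Fin n → Set G.E) : Prop :=
  G.IsMinimalChainDecompOn Set.univ r Gs

/-! ### Subgraphs, trees and edge-independence -/

/-- A subgraph of `G`: a set of vertices together with a set of edges all of whose
endpoints lie in the vertex set. -/
structure Sub (G : MG) where
  verts : Set G.V
  edges : Set G.E
  valid : ∀ e ∈ edges, ∀ v ∈ G.ends e, v ∈ verts

/-- A subgraph is connected. -/
def Sub.Connected {G : MG} (T : Sub G) : Prop :=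
  T.verts.Nonempty ∧ ∀ a ∈ T.verts, ∀ b ∈ T.verts,
    Relation.ReflTransGen (fun x y => ∃ e ∈ T.edges, G.ends e = s(x, y)) a b

/-- A subgraph is a tree: connected and containing no cycle. -/
def Sub.IsTree {G : MG} (T : Sub G) : Prop :=
  T.Connected ∧ ¬ ∃ v vs es, G.IsCycle v vs es ∧ ∀ e ∈ es, e ∈ T.edges

/-- A subgraph is spanning. -/
def Sub.Spanning {G : MG} (T : Sub G) : Prop := T.verts = Set.univ

/-- `vs, es` is a path from `a` to `b` all of whose edges lie in the subgraph `T`. -/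
def Sub.PathIn {G : MG} (T : Sub G) (a b : G.V) (vs : List G.V) (es : List G.E) : Prop :=
  G.IsPath vs es ∧ vs.head? = some a ∧ vs.getLast? = some b ∧ ∀ e ∈ es, e ∈ T.edges

/-- Two subtrees of `G` are edge-independent with root `r`: each contains `r`, and for
every common vertex `v`, the path between `r` and `v` in one tree is edge-disjoint from
the path between `r` and `v` in the other. -/
def EdgeIndependent (r : G.V) (T₁ T₂ : Sub G) : Prop :=
  r ∈ T₁.verts ∧ r ∈ T₂.verts ∧
  ∀ v ∈ T₁.verts ∩ T₂.verts, ∀ vs₁ es₁ vs₂ es₂,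
    T₁.PathIn r v vs₁ es₁ → T₂.PathIn r v vs₂ es₂ → ∀ e ∈ es₁, e ∉ es₂

/-- `G` has a set of four edge-independent spanning trees rooted at `r`. -/
def HasFourEIST (r : G.V) : Prop :=
  ∃ T : Fin 4 → Sub G, (∀ i, (T i).IsTree ∧ (T i).Spanning) ∧
    ∀ i j, i ≠ j → G.EdgeIndependent r (T i) (T j)

/-! ### Mader operations -/

/-- Add to `G` a new edge with the (not necessarily distinct) endpoints `p`. -/
def addEdge (p : Sym2 G.V) : MG :=
  ⟨G.V, Option G.E, fun e => e.elim p G.ends⟩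

/-- Pinch the two distinct edges `e₁` (with ends `x`, `y`) and `e₂` (with ends `z`, `w`):
delete `e₁` and `e₂`, add a new vertex (`none`), and add four new edges joining the new
vertex to `x`, `y`, `z`, `w` respectively. -/
def pinch (e₁ e₂ : G.E) (x y z w : G.V) : MG where
  V := Option G.V
  E := {e : G.E // e ≠ e₁ ∧ e ≠ e₂} ⊕ Fin 4
  ends := fun e =>
    Sum.elim (fun e' => (G.ends e'.1).map some)
      (fun i =>
        if i = 0 then s((none : Option G.V), some x)
        else if i = 1 then s((none : Option G.V), some y)
        else if i = 2 then s((none : Option G.V), some z)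
        else s((none : Option G.V), some w)) e

end MG

/-- A multigraph with a distinguished root vertex. -/
structure PMG : Type 1 where
  G : MG
  r : G.V

/-- A single Mader operation on a rooted multigraph: either add an edge, or pinch two
distinct edges. -/
inductive MaderStep : PMG → PMG → Prop
  | addEdge (P : PMG) (p : Sym2 P.G.V) : MaderStep P ⟨P.G.addEdge p, P.r⟩
  | pinch (P : PMG) (e₁ e₂ : P.G.E) (x y z w : P.G.V) (hne : e₁ ≠ e₂)
      (h₁ : P.G.ends e₁ = s(x, y)) (h₂ : P.G.ends e₂ = s(z, w)) :
      MaderStep P ⟨P.G.pinch e₁ e₂ x y z w, some P.r⟩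

/-- The starting graph `G⁰` of the Mader construction: two vertices joined by four
parallel edges, rooted at one of them. -/
def basePMG : PMG :=
  ⟨⟨Bool, Fin 4, fun _ => s(false, true)⟩, false⟩

/-- An isomorphism of rooted multigraphs: bijections on vertices and edges commuting
with the endpoint maps and sending root to root. -/
def PIso (P Q : PMG) : Prop :=
  ∃ (fV : P.G.V ≃ Q.G.V) (fE : P.G.E ≃ Q.G.E),
    (∀ e, Q.G.ends (fE e) = (P.G.ends e).map fV) ∧ fV P.r = Q.r

/-- `G`, rooted at `r`, can be built from `basePMG` by repeatedly performing
Mader operations. -/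
def MaderConstructible (G : MG) (r : G.V) : Prop :=
  ∃ Q : PMG, Relation.ReflTransGen MaderStep basePMG Q ∧ PIso Q ⟨G, r⟩

namespace MG

theorem mem_vertsOf_of_two_le_deg {G : MG} {F : Set G.E} {v : G.V} (h : 2 ≤ G.deg F v) :
    v ∈ G.vertsOf F := by
  by_contra hv
  have h₁ : {e ∈ F | v ∈ G.ends e} = ∅ := by
    ext e
    simp only [Set.mem_ofPred_eq, Set.mem_empty_iff_false, iff_false]
    exact fun he => hv ⟨e, he.1, he.2⟩
  have h₂ : {e ∈ F | G.ends e = s(v, v)} = ∅ := by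
    ext e
    simp only [Set.mem_ofPred_eq, Set.mem_empty_iff_false, iff_false]
    exact fun he => hv ⟨e, he.1, by simp [he.2]⟩
  simp [deg, h₁, h₂] at h

theorem Reach.mono {G : MG} {F F' : Set G.E} (h : F ⊆ F') {a b : G.V} (hab : G.Reach F a b) :
    G.Reach F' a b :=
  Relation.ReflTransGen.mono (fun _ _ ⟨e, he, hl⟩ => ⟨e, h he, hl⟩) _ _ hab

theorem Reach.symm {G : MG} {F : Set G.E} {a b : G.V} (hab : G.Reach F a b) : G.Reach F b a := by
  induction hab with
  | refl => exact Relation.ReflTransGen.refl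
  | tail _ h ih =>
    obtain ⟨e, he, hl⟩ := h
    exact Relation.ReflTransGen.head ⟨e, he, hl.trans Sym2.eq_swap⟩ ih

theorem IsLink.reach {G : MG} {a : G.V} {vs : List G.V} {es : List G.E}
    (h : G.IsLink (a :: vs) es) {v : G.V} (hv : v ∈ G.vertsOf {e | e ∈ es}) :
    G.Reach {e | e ∈ es} a v := by
  induction vs generalizing a es with
  | nil =>
    cases es with
    | nil => obtain ⟨e, he, -⟩ := hv; simp at he
    | cons => exact h.elim
  | cons b vs ih =>
    cases es with
    | nil => exact h.elim
    | cons e es =>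
      have hab : G.Reach {x | x ∈ e :: es} a b :=
        Relation.ReflTransGen.single ⟨e, by simp, h.1⟩
      obtain ⟨x, hx, hxv⟩ := hv
      rcases List.mem_cons.1 hx with rfl | hx
      · rw [h.1, Sym2.mem_iff] at hxv
        rcases hxv with rfl | rfl
        · exact Relation.ReflTransGen.refl
        · exact hab
      · exact hab.trans ((ih h.2 ⟨x, hx, hxv⟩).mono fun y hy => List.mem_cons_of_mem e hy)

theorem IsChain.symm {G : MG} {r : G.V} {H Hb C : Set G.E} (h : G.IsChain r H Hb C) :
    G.IsChain r Hb H C := by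
  rcases h with h | h | ⟨u, v, e, h₁, h₂, h₃, h₄, h₅, h₆⟩
  · exact Or.inr (Or.inl h)
  · exact Or.inl h
  · exact Or.inr (Or.inr ⟨v, u, e, h₂, h₁, h₃, h₄.trans Sym2.eq_swap, h₆, h₅⟩)

/-- Every chain is connected from a vertex that is the root or lies in `H`. -/
theorem IsChain.exists_reach {G : MG} {r : G.V} {H Hb C : Set G.E} (h : G.IsChain r H Hb C) :
    ∃ w, (w = r ∨ w ∈ G.vertsOf H) ∧ ∀ v ∈ G.vertsOf C, G.Reach C w v := by
  rcases h with (⟨-, -, vs, es, hp, -, rfl, -, hhead, -⟩ | ⟨v, -, -, vs, es, hc, rfl, -, hv⟩) |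
    (⟨-, -, vs, es, hp, -, rfl, hall, -⟩ | ⟨v, -, -, vs, es, hc, rfl, hall, -⟩) |
    ⟨u, v, e, -, -, rfl, he, hu, -⟩
  · cases vs with
    | nil => exact hp.2.2.elim
    | cons a vs => exact ⟨a, hhead a rfl, fun _ => hp.2.2.reach⟩
  · exact ⟨v, hv.imp_right mem_vertsOf_of_two_le_deg, fun _ => hc.2.2.2.reach⟩
  · cases vs with
    | nil => exact hp.2.2.elim
    | cons a vs =>
      exact ⟨a, (hall a (by simp)).imp_right mem_vertsOf_of_two_le_deg, fun _ => hp.2.2.reach⟩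
  · exact ⟨v, (hall v (by simp)).imp_right mem_vertsOf_of_two_le_deg, fun _ => hc.2.2.2.reach⟩
  · refine ⟨u, hu.imp_right mem_vertsOf_of_two_le_deg, ?_⟩
    rintro x ⟨f, rfl, hx⟩
    rw [he, Sym2.mem_iff] at hx
    rcases hx with rfl | rfl
    · exact Relation.ReflTransGen.refl
    · exact Relation.ReflTransGen.single ⟨f, rfl, he⟩

theorem reach_root_before {G : MG} {r : G.V} {n : ℕ} {Gs : Fin n → Set G.E}
    (h : ∀ i, G.IsChain r (G.before Gs i) (G.after Gs i) (Gs i)) (i : Fin n) :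
    ∀ v ∈ G.vertsOf (G.before Gs i), G.Reach (G.before Gs i) r v := by
  induction i using WellFoundedLT.induction with
  | ind i ih =>
    rintro v ⟨e, ⟨j, hj, he⟩, hv⟩
    obtain ⟨w, hw, hreach⟩ := (h j).exists_reach
    have hwv : G.Reach (G.before Gs i) w v := by
      refine (hreach v ⟨e, he, hv⟩).mono ?_
      intro x hx
      exact ⟨j, hj, hx⟩
    rcases hw with rfl | hw
    · exact hwv
    · refine Relation.ReflTransGen.trans ((ih j hj w hw).mono ?_) hwv
      rintro x ⟨l, hl, hx⟩
      exact ⟨l, hl.trans hj, hx⟩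

theorem connectedWithin_before {G : MG} {r : G.V} {n : ℕ} {Gs : Fin n → Set G.E}
    (h : ∀ i, G.IsChain r (G.before Gs i) (G.after Gs i) (Gs i)) (i : Fin n) :
    G.ConnectedWithin (G.before Gs i) :=
  fun a ha b hb => (reach_root_before h i a ha).symm.trans (reach_root_before h i b hb)

theorem before_comp_rev {G : MG} {n : ℕ} (Gs : Fin n → Set G.E) (i : Fin n) :
    G.before (Gs ∘ Fin.rev) i = G.after Gs i.rev := by
  ext e
  constructor
  · rintro ⟨j, hj, he⟩
    exact ⟨j.rev, Fin.rev_lt_rev.2 hj, he⟩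
  · rintro ⟨j, hj, he⟩
    exact ⟨j.rev, by simpa using Fin.rev_lt_rev.2 hj, by simpa using he⟩

theorem after_comp_rev {G : MG} {n : ℕ} (Gs : Fin n → Set G.E) (i : Fin n) :
    G.after (Gs ∘ Fin.rev) i = G.before Gs i.rev := by
  have h := before_comp_rev (Gs ∘ Fin.rev) i.rev
  rw [Fin.rev_rev] at h
  rw [← h]
  congr 1
  funext j
  simp

theorem connectedWithin_after {G : MG} {r : G.V} {n : ℕ} {Gs : Fin n → Set G.E}
    (h : ∀ i, G.IsChain r (G.before Gs i) (G.after Gs i) (Gs i)) (i : Fin n) :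
    G.ConnectedWithin (G.after Gs i) := by
  have hrev : ∀ j, G.IsChain r (G.before (Gs ∘ Fin.rev) j) (G.after (Gs ∘ Fin.rev) j)
      ((Gs ∘ Fin.rev) j) := fun j => by
    rw [before_comp_rev, after_comp_rev]
    exact (h j.rev).symm
  simpa [before_comp_rev] using connectedWithin_before hrev i.rev

end MG

theorem partial_chain_decomp_connected (G : MG) [Finite G.V] [Finite G.E]
    (r : G.V) (m : ℕ) (Gs : Fin (m + 1) → Set G.E) (h : G.IsChainDecomp r Gs)
    (i k : Fin (m + 1)) (hik : (k : ℕ) + 1 = (i : ℕ)) :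
    G.ConnectedWithin (G.before Gs i) ∧ G.ConnectedWithin (G.after Gs k) :=
  ⟨MG.connectedWithin_before h.2.2 i, MG.connectedWithin_after h.2.2 k⟩
end

section
/- Suppose G_0, G_1, …, G_m is a chain decomposition of a multigraph G rooted at r, and let v ≠ r be a vertex. If v lies in H_i, then v is incident to a non-loop edge of H_i; and if v has degree at least two in H_i, then v is incident to two distinct non-loop edges of H_i. The same statements hold with H_i replaced by Hbar_i. -/
set_option autoImplicit false

namespace MG

variable {G : MG}

/-- If an edge in a linked walk is a loop at `v`, then `v` is repeated in the walk. -/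
lemma IsLink.not_nodup_of_loop {v : G.V} {e : G.E} (hl : G.ends e = s(v, v)) :
    ∀ {vs : List G.V} {es : List G.E}, G.IsLink vs es → e ∈ es → ¬ vs.Nodup
  | [], _, h, _ => by simp [IsLink] at h
  | [_], [], _, he => by simp at he
  | [_], _ :: _, h, _ => by simp [IsLink] at h
  | _ :: _ :: _, [], _, he => by simp at he
  | a :: b :: vs, e' :: es, h, he => by
    intro hn
    rcases List.mem_cons.1 he with rfl | he
    · have hab := hl.symm.trans h.1
      simp only [Sym2.eq_iff] at hab
      grind
    · exact IsLink.not_nodup_of_loop hl h.2 he hn.of_cons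

/-- The only loops on a simple cycle are at its basepoint. -/
lemma IsCycle.eq_of_loop {v w : G.V} {vs : List G.V} {es : List G.E} {e : G.E}
    (h : G.IsCycle w vs es) (he : e ∈ es) (hl : G.ends e = s(v, v)) : v = w := by
  obtain ⟨hn, -, -, h⟩ := h
  obtain _ | ⟨e', es⟩ := es
  · simp at he
  cases vs with
  | nil =>
    cases es with
    | nil =>
      obtain rfl : e = e' := by simpa using he
      have := hl.symm.trans h.1
      simp only [Sym2.eq_iff] at this
      grind
    | cons _ _ => exact h.2.elim
  | cons a vs =>
    exfalso
    rcases List.mem_cons.1 he with rfl | he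
    · have := hl.symm.trans h.1
      simp only [Sym2.eq_iff] at this
      grind
    · refine IsLink.not_nodup_of_loop hl h.2 he ?_
      change ((a :: vs) ++ [w]).Nodup
      grind

lemma IsUpChain.two_le_deg_of_loop {r v : G.V} {H Hb C : Set G.E} {e : G.E}
    (h : G.IsUpChain r H Hb C) (hv : v ≠ r) (he : e ∈ C) (hl : G.ends e = s(v, v)) :
    2 ≤ G.deg H v ∧ 2 ≤ G.deg Hb v := by
  rcases h with ⟨-, -, vs, es, hp, -, rfl, -⟩ | ⟨w, -, -, vs, es, hc, rfl, hHb, hH⟩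
  · exact (IsLink.not_nodup_of_loop hl hp.2.2 he hp.1).elim
  · obtain rfl := hc.eq_of_loop he hl
    exact ⟨hH.resolve_left hv, (hHb v (by simp)).resolve_left hv⟩

/-- A chain containing a loop at a vertex other than the root forces that vertex to have
degree at least two on both sides. -/
lemma IsChain.two_le_deg_of_loop {r v : G.V} {H Hb C : Set G.E} {e : G.E}
    (h : G.IsChain r H Hb C) (hv : v ≠ r) (he : e ∈ C) (hl : G.ends e = s(v, v)) :
    2 ≤ G.deg H v ∧ 2 ≤ G.deg Hb v := by
  rcases h with h | h | ⟨a, b, e', -, -, rfl, hab, ha, hb⟩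
  · exact h.two_le_deg_of_loop hv he hl
  · exact (IsUpChain.two_le_deg_of_loop h hv he hl).symm
  · obtain rfl : e = e' := he
    have := hl.symm.trans hab
    simp only [Sym2.eq_iff] at this
    obtain ⟨rfl, rfl⟩ : v = a ∧ v = b := by grind
    exact ⟨ha.resolve_left hv, hb.resolve_left hv⟩

lemma ends_eq_of_mem_of_isDiag {v : G.V} {e : G.E} (he : v ∈ G.ends e)
    (hd : (G.ends e).IsDiag) : G.ends e = s(v, v) := by
  revert he hd
  generalize G.ends e = z
  induction z with
  | _ x y =>
    simp only [Sym2.mem_iff, Sym2.mk_isDiag_iff]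
    grind

/-- A vertex of degree at least two that carries no loops has two incident non-loop edges. -/
lemma exists_two_nonloop_of_two_le_deg [Finite G.E] {F : Set G.E} {v : G.V}
    (h : 2 ≤ G.deg F v) (hF : ∀ e ∈ F, G.ends e ≠ s(v, v)) :
    ∃ e₁ ∈ F, ∃ e₂ ∈ F, e₁ ≠ e₂ ∧
      v ∈ G.ends e₁ ∧ ¬ (G.ends e₁).IsDiag ∧ v ∈ G.ends e₂ ∧ ¬ (G.ends e₂).IsDiag := by
  have h0 : {e ∈ F | G.ends e = s(v, v)} = ∅ := by
    ext e
    simpa using hF e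
  rw [deg, h0, Set.ncard_empty, add_zero] at h
  obtain ⟨e₁, e₂, ⟨h₁, hv₁⟩, ⟨h₂, hv₂⟩, hne⟩ := (Set.one_lt_ncard_iff (Set.toFinite _)).1 h
  exact ⟨e₁, h₁, e₂, h₂, hne, hv₁, fun hd => hF _ h₁ (ends_eq_of_mem_of_isDiag hv₁ hd),
    hv₂, fun hd => hF _ h₂ (ends_eq_of_mem_of_isDiag hv₂ hd)⟩

section WellFounded

variable {ι : Type*} {R : ι → ι → Prop} [IsTrans ι R] {Gs : ι → Set G.E} {v : G.V}

lemma exists_two_nonloop_of_wellFounded [Finite G.E] (wf : WellFounded R)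
    (hloop : ∀ i, ∀ e ∈ Gs i, G.ends e = s(v, v) → 2 ≤ G.deg {e | ∃ j, R j i ∧ e ∈ Gs j} v)
    (i : ι) (h : 2 ≤ G.deg {e | ∃ j, R j i ∧ e ∈ Gs j} v) :
    ∃ e₁ ∈ {e | ∃ j, R j i ∧ e ∈ Gs j}, ∃ e₂ ∈ {e | ∃ j, R j i ∧ e ∈ Gs j}, e₁ ≠ e₂ ∧
      v ∈ G.ends e₁ ∧ ¬ (G.ends e₁).IsDiag ∧ v ∈ G.ends e₂ ∧ ¬ (G.ends e₂).IsDiag := by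
  induction i using wf.induction with
  | _ i ih =>
    by_cases hF : ∀ e ∈ {e | ∃ j, R j i ∧ e ∈ Gs j}, G.ends e ≠ s(v, v)
    · exact exists_two_nonloop_of_two_le_deg h hF
    · push Not at hF
      obtain ⟨e, ⟨j, hji, he⟩, hl⟩ := hF
      obtain ⟨e₁, ⟨j₁, h₁, he₁⟩, e₂, ⟨j₂, h₂, he₂⟩, hrest⟩ := ih j hji (hloop j e he hl)
      exact ⟨e₁, ⟨j₁, _root_.trans h₁ hji, he₁⟩, e₂, ⟨j₂, _root_.trans h₂ hji, he₂⟩, hrest⟩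

lemma exists_nonloop_of_wellFounded [Finite G.E] (wf : WellFounded R)
    (hloop : ∀ i, ∀ e ∈ Gs i, G.ends e = s(v, v) → 2 ≤ G.deg {e | ∃ j, R j i ∧ e ∈ Gs j} v)
    (i : ι) (h : v ∈ G.vertsOf {e | ∃ j, R j i ∧ e ∈ Gs j}) :
    ∃ e ∈ {e | ∃ j, R j i ∧ e ∈ Gs j}, v ∈ G.ends e ∧ ¬ (G.ends e).IsDiag := by
  obtain ⟨e, ⟨j, hji, he⟩, hve⟩ := h
  by_cases hd : (G.ends e).IsDiag
  · obtain ⟨e₁, ⟨j₁, h₁, he₁⟩, -, -, -, hv₁, hd₁, -⟩ :=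
      exists_two_nonloop_of_wellFounded wf hloop j
        (hloop j e he (ends_eq_of_mem_of_isDiag hve hd))
    exact ⟨e₁, ⟨j₁, _root_.trans h₁ hji, he₁⟩, hv₁, hd₁⟩
  · exact ⟨e, ⟨j, hji, he⟩, hve, hd⟩

end WellFounded

end MG


theorem incident_nonloop_edges (G : MG) [Finite G.V] [Finite G.E]
    (r : G.V) (m : ℕ) (Gs : Fin (m + 1) → Set G.E) (h : G.IsChainDecomp r Gs)
    (v : G.V) (hv : v ≠ r) (i : Fin (m + 1)) :
    (v ∈ G.vertsOf (G.before Gs i) →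
      ∃ e ∈ G.before Gs i, v ∈ G.ends e ∧ ¬ (G.ends e).IsDiag) ∧
    (2 ≤ G.deg (G.before Gs i) v →
      ∃ e₁ ∈ G.before Gs i, ∃ e₂ ∈ G.before Gs i, e₁ ≠ e₂ ∧
        v ∈ G.ends e₁ ∧ ¬ (G.ends e₁).IsDiag ∧ v ∈ G.ends e₂ ∧ ¬ (G.ends e₂).IsDiag) ∧
    (v ∈ G.vertsOf (G.after Gs i) →
      ∃ e ∈ G.after Gs i, v ∈ G.ends e ∧ ¬ (G.ends e).IsDiag) ∧
    (2 ≤ G.deg (G.after Gs i) v →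
      ∃ e₁ ∈ G.after Gs i, ∃ e₂ ∈ G.after Gs i, e₁ ≠ e₂ ∧
        v ∈ G.ends e₁ ∧ ¬ (G.ends e₁).IsDiag ∧ v ∈ G.ends e₂ ∧ ¬ (G.ends e₂).IsDiag) := by
  have hbefore : ∀ i, ∀ e ∈ Gs i, G.ends e = s(v, v) → 2 ≤ G.deg (G.before Gs i) v :=
    fun i _ he hl => ((h.2.2 i).two_le_deg_of_loop hv he hl).1
  have hafter : ∀ i, ∀ e ∈ Gs i, G.ends e = s(v, v) → 2 ≤ G.deg (G.after Gs i) v :=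
    fun i _ he hl => ((h.2.2 i).two_le_deg_of_loop hv he hl).2
  exact ⟨MG.exists_nonloop_of_wellFounded (R := (· < ·)) wellFounded_lt hbefore i,
    MG.exists_two_nonloop_of_wellFounded (R := (· < ·)) wellFounded_lt hbefore i,
    MG.exists_nonloop_of_wellFounded (R := (· > ·)) wellFounded_gt hafter i,
    MG.exists_two_nonloop_of_wellFounded (R := (· > ·)) wellFounded_gt hafter i⟩
end

section
/- Suppose G is a multigraph with no isolated vertices, G_0, G_1, …, G_m is a chain decomposition of G rooted at r, and v ≠ r is a vertex of G. Then v has degree at least 4 in G. -/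
set_option autoImplicit false

namespace MG

variable {G : MG}

lemma IsLink.mem_of_mem_ends {l : List G.V} {es : List G.E} (h : G.IsLink l es)
    {e : G.E} (he : e ∈ es) {v : G.V} (hv : v ∈ G.ends e) : v ∈ l := by
  induction es generalizing l with
  | nil => simp at he
  | cons f es ih =>
    match l, h with
    | a :: b :: vs, ⟨hab, hl⟩ =>
      rcases List.mem_cons.1 he with rfl | he
      · rw [hab, Sym2.mem_iff] at hv
        rcases hv with rfl | rfl <;> simp
      · exact List.mem_cons_of_mem _ (ih hl he)

section Degree

variable [Finite G.E] {A B : Set G.E} {v : G.V}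

lemma deg_le_deg (h : ∀ e ∈ A, v ∈ G.ends e → e ∈ B) : G.deg A v ≤ G.deg B v := by
  refine Nat.add_le_add (Set.ncard_le_ncard ?_ (Set.toFinite _))
    (Set.ncard_le_ncard ?_ (Set.toFinite _))
  · exact fun e he => ⟨h e he.1 he.2, he.2⟩
  · exact fun e he => ⟨h e he.1 (by simp [he.2]), he.2⟩

lemma deg_union (h : Disjoint A B) : G.deg (A ∪ B) v = G.deg A v + G.deg B v := by
  have key : ∀ p : G.E → Prop,
      {e ∈ A ∪ B | p e}.ncard = {e ∈ A | p e}.ncard + {e ∈ B | p e}.ncard := fun p => by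
    rw [← Set.ncard_union_eq (h.mono (Set.sep_subset _ _) (Set.sep_subset _ _))
      (Set.toFinite _) (Set.toFinite _)]
    congr 1
    ext e
    simp [or_and_right]
  simp only [deg, key]
  omega

lemma one_le_deg (h : v ∈ G.vertsOf A) : 1 ≤ G.deg A v := by
  obtain ⟨e, he, hv⟩ := h
  exact Nat.le_add_right_of_le ((Set.ncard_pos (Set.toFinite _)).2 ⟨e, he, hv⟩)

lemma mem_vertsOf_of_deg_pos (h : 0 < G.deg A v) : v ∈ G.vertsOf A := by
  by_contra hv
  have h0 : G.deg A v ≤ G.deg (∅ : Set G.E) v :=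
    deg_le_deg fun e he hve => (hv ⟨e, he, hve⟩).elim
  have hempty : G.deg (∅ : Set G.E) v = 0 := by simp [deg]
  omega

end Degree

section Chain

variable {r v : G.V} {H Hb C : Set G.E}

lemma IsUpChain.two_le_deg_right (h : G.IsUpChain r H Hb C) (hv : v ≠ r)
    (hC : v ∈ G.vertsOf C) : 2 ≤ G.deg Hb v := by
  obtain ⟨e, he, hve⟩ := hC
  rcases h with ⟨_, _, vs, es, ⟨_, _, hl⟩, _, rfl, hd, _⟩ |
    ⟨w, _, _, vs, es, ⟨_, _, _, hl⟩, rfl, hd, _⟩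
  · exact (hd v (hl.mem_of_mem_ends he hve)).resolve_left hv
  · refine (hd v ?_).resolve_left hv
    simpa [or_comm, or_assoc] using hl.mem_of_mem_ends he hve

/-- A vertex of a chain other than the root has degree at least two on one side. -/
lemma IsChain.two_le_deg (h : G.IsChain r H Hb C) (hv : v ≠ r) (hC : v ∈ G.vertsOf C) :
    2 ≤ G.deg H v ∨ 2 ≤ G.deg Hb v := by
  rcases h with h | h | ⟨a, b, e, _, _, rfl, he, ha, hb⟩
  · exact .inr (h.two_le_deg_right hv hC)
  · exact .inl (IsUpChain.two_le_deg_right h hv hC)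
  · obtain ⟨_, rfl, hve⟩ := hC
    rw [he, Sym2.mem_iff] at hve
    rcases hve with rfl | rfl
    · exact .inl (ha.resolve_left hv)
    · exact .inr (hb.resolve_left hv)

end Chain

end MG

theorem min_degree_four (G : MG) [Finite G.V] [Finite G.E]
    (hni : G.NoIsolated) (r : G.V) (m : ℕ) (Gs : Fin (m + 1) → Set G.E)
    (h : G.IsChainDecomp r Gs) (v : G.V) (hv : v ≠ r) :
    4 ≤ G.deg Set.univ v := by
  obtain ⟨hdisj, hcov, hch⟩ := h
  have hcov' : ∀ e, ∃ i, e ∈ Gs i := fun e => by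
    simpa using hcov.symm.subset (Set.mem_univ e)
  have split : ∀ i, G.deg (G.before Gs i) v + G.deg (Gs i) v + G.deg (G.after Gs i) v ≤
      G.deg Set.univ v := fun i => by
    have h₁ : Disjoint (G.before Gs i) (Gs i) := Set.disjoint_left.2 fun e ⟨j, hj, he⟩ he' =>
      Set.disjoint_left.1 (hdisj j i hj.ne) he he'
    have h₂ : Disjoint (G.before Gs i ∪ Gs i) (G.after Gs i) := by
      refine Set.disjoint_left.2 ?_
      rintro e (⟨j, hj, he⟩ | he) ⟨k, hk, he'⟩
      · exact Set.disjoint_left.1 (hdisj j k (hj.trans hk).ne) he he'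
      · exact Set.disjoint_left.1 (hdisj i k hk.ne) he he'
    rw [← MG.deg_union h₁, ← MG.deg_union h₂]
    exact MG.deg_le_deg fun _ _ _ => Set.mem_univ _
  -- the first chain through `v`
  obtain ⟨i, hi, hmin⟩ : ∃ i, v ∈ G.vertsOf (Gs i) ∧ ∀ j < i, v ∉ G.vertsOf (Gs j) := by
    obtain ⟨e, hve⟩ := hni v
    obtain ⟨i₀, he⟩ := hcov' e
    obtain ⟨i, hi⟩ := {i | v ∈ G.vertsOf (Gs i)}.toFinite.exists_minimal ⟨i₀, e, he, hve⟩
    exact ⟨i, hi.prop, fun j hj hvj => hi.not_prop_of_lt hj hvj⟩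
  have hbefore : G.deg (G.before Gs i) v = 0 := by
    by_contra h0
    obtain ⟨e, ⟨j, hj, he⟩, hve⟩ := MG.mem_vertsOf_of_deg_pos (Nat.pos_of_ne_zero h0)
    exact hmin j hj ⟨e, he, hve⟩
  have hafter : 2 ≤ G.deg (G.after Gs i) v := ((hch i).two_le_deg hv hi).resolve_left (by omega)
  have hsi := split i
  by_contra! hlt
  -- the second chain through `v`
  obtain ⟨k, ⟨hik, hk⟩, hkmin⟩ : ∃ k, (i < k ∧ v ∈ G.vertsOf (Gs k)) ∧
      ∀ j < k, ¬ (i < j ∧ v ∈ G.vertsOf (Gs j)) := by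
    obtain ⟨e, ⟨k₀, hk₀, he⟩, hve⟩ := MG.mem_vertsOf_of_deg_pos (Nat.zero_lt_of_lt hafter)
    obtain ⟨k, hk⟩ := {k | i < k ∧ v ∈ G.vertsOf (Gs k)}.toFinite.exists_minimal
      ⟨k₀, hk₀, e, he, hve⟩
    exact ⟨k, hk.prop, fun j hj hvj => hk.not_prop_of_lt hj hvj⟩
  have hle : G.deg (G.before Gs k) v ≤ G.deg (Gs i) v := by
    refine MG.deg_le_deg fun e ⟨j, hj, he⟩ hve => ?_
    rcases lt_trichotomy j i with hji | rfl | hij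
    · exact (hmin j hji ⟨e, he, hve⟩).elim
    · exact he
    · exact (hkmin j hj ⟨hij, e, he, hve⟩).elim
  have hge : G.deg (Gs i) v ≤ G.deg (G.before Gs k) v :=
    MG.deg_le_deg fun e he _ => ⟨i, hik, he⟩
  have h1 := MG.one_le_deg hi
  have h2 := MG.one_le_deg hk
  have hsk := split k
  have h3 := (hch k).two_le_deg hv hk
  omega
end
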